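/- Let P and Q be probability distributions on finite sets, neither of which is a uniform distribution (so V(P) > 0 and V(Q) > 0), and suppose H(P)/V(P) < H(Q)/V(Q). Then for every b ∈ ℝ the equation N_P(x)/N_{P,Q,b}(x) = (1 − G_P(x))/(1 − G_{P,Q,b}(x)) has a unique real solution x = β. -/

import Mathlib

open MeasureTheory Filter

namespace RNG

variable {α β : Type*}

/-- `P` is a probability distribution on the finite set `α`. -/
def IsProb [Fintype α] (P : α → ℝ) : Prop :=
  (∀ x, 0 ≤ P x) ∧ ∑ x, P x = 1

open Classical in
/-- Pushforward distribution `W(P)(y) = ∑_{x : W x = y} P x`. -/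
noncomputable def push [Fintype α] (W : α → β) (P : α → ℝ) : β → ℝ :=
  fun y => ∑ x, if W x = y then P x else 0

/-- Fidelity (Bhattacharyya coefficient) between distributions on the same finite set. -/
noncomputable def fid [Fintype β] (R S : β → ℝ) : ℝ :=
  ∑ y, Real.sqrt (R y * S y)

/-- Sum of the `l` largest values of `P`, i.e. the `l`-th partial sum of the
decreasing rearrangement of `P` (padded with zeros). -/
noncomputable def topSum [Fintype α] (P : α → ℝ) (l : ℕ) : ℝ :=
  sSup {s : ℝ | ∃ A : Finset α, A.card ≤ l ∧ s = ∑ x ∈ A, P x}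

/-- Majorization `P ≺ P'` (the distributions may live on different finite sets). -/
def Maj [Fintype α] [Fintype β] (P : α → ℝ) (P' : β → ℝ) : Prop :=
  ∀ l : ℕ, topSum P l ≤ topSum P' l

/-- Maximal fidelity under deterministic transformations,
`F^D(P → Q) = max {F(W(P), Q) | W : α → β}`. -/
noncomputable def FD [Fintype α] [Fintype β] (P : α → ℝ) (Q : β → ℝ) : ℝ :=
  sSup {r : ℝ | ∃ W : α → β, r = fid (push W P) Q}

/-- Maximal fidelity under the majorization condition,
`F^M(P → Q) = max {F(P', Q) | P ≺ P', P'` a distribution on the target set`}`. -/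
noncomputable def FM [Fintype α] [Fintype β] (P : α → ℝ) (Q : β → ℝ) : ℝ :=
  sSup {r : ℝ | ∃ P' : β → ℝ, IsProb P' ∧ Maj P P' ∧ r = fid P' Q}

/-- Shannon entropy (natural logarithm). -/
noncomputable def H [Fintype α] (P : α → ℝ) : ℝ := ∑ x, -(P x * Real.log (P x))

/-- Varentropy `V(P)` (natural logarithm). -/
noncomputable def V [Fintype α] (P : α → ℝ) : ℝ :=
  ∑ x, P x * (-Real.log (P x) - H P) ^ 2

/-- Shannon entropy, base-2 logarithm. -/
noncomputable def H2 [Fintype α] (P : α → ℝ) : ℝ := ∑ x, -(P x * Real.logb 2 (P x))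

/-- Varentropy, base-2 logarithm. -/
noncomputable def V2 [Fintype α] (P : α → ℝ) : ℝ :=
  ∑ x, P x * (-Real.logb 2 (P x) - H2 P) ^ 2

/-- The `n`-fold i.i.d. product distribution `P^n`. -/
noncomputable def iid [Fintype α] (P : α → ℝ) (n : ℕ) : (Fin n → α) → ℝ :=
  fun f => ∏ i, P (f i)

/-- The uniform distribution on a two-element set. -/
noncomputable def U2 : Fin 2 → ℝ := fun _ => 1 / 2

/-- Density of the normal distribution `N(m, v)`. -/
noncomputable def normalPDF (m v t : ℝ) : ℝ :=
  (Real.sqrt (2 * Real.pi * v))⁻¹ * Real.exp (-(t - m) ^ 2 / (2 * v))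

/-- Standard normal cumulative distribution function `G`. -/
noncomputable def stdG (x : ℝ) : ℝ := ∫ t in Set.Iic x, normalPDF 0 1 t

/-- Density `N_P` of `N(0, V(P))`. -/
noncomputable def NP [Fintype α] (P : α → ℝ) (x : ℝ) : ℝ := normalPDF 0 (V P) x

/-- Density `N_{P,Q,b}` of `N(H(Q)b, (H(P)/H(Q))·V(Q))`. -/
noncomputable def NPQ [Fintype α] [Fintype β] (P : α → ℝ) (Q : β → ℝ) (b x : ℝ) : ℝ :=
  normalPDF (H Q * b) (H P / H Q * V Q) x

/-- Cdf `G_P(x) = G(x/√V(P))`. -/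
noncomputable def GP [Fintype α] (P : α → ℝ) (x : ℝ) : ℝ := stdG (x / Real.sqrt (V P))

/-- Cdf `G_{P,Q,b}(x) = G(√(H(Q)/(H(P)V(Q)))·(x − H(Q)b))`. -/
noncomputable def GPQ [Fintype α] [Fintype β] (P : α → ℝ) (Q : β → ℝ) (b x : ℝ) : ℝ :=
  stdG (Real.sqrt (H Q / (H P * V Q)) * (x - H Q * b))

/-- `I_{P,Q,b}(x) = ∫_{−∞}^x √(N_P(t) N_{P,Q,b}(t)) dt`. -/
noncomputable def IPQ [Fintype α] [Fintype β] (P : α → ℝ) (Q : β → ℝ) (b x : ℝ) : ℝ :=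
  ∫ t in Set.Iic x, Real.sqrt (NP P t * NPQ P Q b t)

/-- `I_{P,Q,b}(∞) = ∫_ℝ √(N_P(t) N_{P,Q,b}(t)) dt`. -/
noncomputable def IPQinf [Fintype α] [Fintype β] (P : α → ℝ) (Q : β → ℝ) (b : ℝ) : ℝ :=
  ∫ t : ℝ, Real.sqrt (NP P t * NPQ P Q b t)

/-- `L^D_n(P,Q|ν)`: the maximal `L` with `F^D(P^n → Q^L) ≥ ν`. -/
noncomputable def LD [Fintype α] [Fintype β] (P : α → ℝ) (Q : β → ℝ) (ν : ℝ) (n : ℕ) : ℕ :=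
  sSup {L : ℕ | ν ≤ FD (iid P n) (iid Q L)}

/-- The optimal second order rate `R^D_2(P,Q|ν)`. -/
noncomputable def RD2 [Fintype α] [Fintype β] (P : α → ℝ) (Q : β → ℝ) (ν : ℝ) : ℝ :=
  sSup {b : ℝ | ∃ c : ℝ, ν ≤ c ∧
    Tendsto (fun n : ℕ =>
      FD (iid P n) (iid Q (⌊H P / H Q * n + b * Real.sqrt n⌋₊))) atTop (nhds c)}

lemma IsProb.le_one {X : Type*} [Fintype X] {P : X → ℝ} (hP : IsProb P) (x : X) : P x ≤ 1 :=
  hP.2 ▸ Finset.single_le_sum (fun i _ => hP.1 i) (Finset.mem_univ x)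

lemma H_pos_of_V_pos {X : Type*} [Fintype X] {P : X → ℝ} (hP : IsProb P) (hV : 0 < V P) :
    0 < H P := by
  have hterm : ∀ x ∈ Finset.univ, 0 ≤ -(P x * Real.log (P x)) := fun x _ =>
    neg_nonneg.2 (mul_nonpos_of_nonneg_of_nonpos (hP.1 x)
      (Real.log_nonpos (hP.1 x) (hP.le_one x)))
  refine (Finset.sum_nonneg hterm).lt_of_ne fun h0 => hV.ne' ?_
  have hH : H P = 0 := h0.symm
  refine Finset.sum_eq_zero fun x hx => ?_
  have hx0 : P x * Real.log (P x) = 0 := by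
    simpa using (Finset.sum_eq_zero_iff_of_nonneg hterm).1 hH x hx
  rw [hH]
  linear_combination Real.log (P x) * hx0

lemma normalPDF_pos {v : ℝ} (hv : 0 < v) (m t : ℝ) : 0 < normalPDF m v t := by
  unfold normalPDF
  positivity

lemma continuous_normalPDF (m v : ℝ) : Continuous (normalPDF m v) := by
  unfold normalPDF
  fun_prop

lemma normalPDF_zero_one : normalPDF 0 1 = ProbabilityTheory.gaussianPDFReal 0 1 := by
  ext t
  simp [normalPDF, ProbabilityTheory.gaussianPDFReal]

lemma integrable_normalPDF_zero_one : Integrable (normalPDF 0 1) :=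
  normalPDF_zero_one ▸ ProbabilityTheory.integrable_gaussianPDFReal 0 1

lemma integral_normalPDF_zero_one : ∫ t, normalPDF 0 1 t = 1 :=
  normalPDF_zero_one ▸ ProbabilityTheory.integral_gaussianPDFReal_eq_one 0 one_ne_zero

lemma hasDerivAt_stdG (x : ℝ) : HasDerivAt stdG (normalPDF 0 1 x) x := by
  have heq : stdG = fun y => stdG 0 + ∫ t in (0 : ℝ)..y, normalPDF 0 1 t := by
    ext y
    have := intervalIntegral.integral_Iic_sub_Iic (a := 0) (b := y)
      integrable_normalPDF_zero_one.integrableOn integrable_normalPDF_zero_one.integrableOn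
    simp only [stdG]
    linarith
  rw [heq]
  exact (intervalIntegral.integral_hasDerivAt_right
    ((continuous_normalPDF 0 1).intervalIntegrable _ _)
    (continuous_normalPDF 0 1).aestronglyMeasurable.stronglyMeasurableAtFilter
    (continuous_normalPDF 0 1).continuousAt).const_add _

lemma strictMono_stdG : StrictMono stdG :=
  strictMono_of_hasDerivAt_pos hasDerivAt_stdG fun x => normalPDF_pos one_pos 0 x

lemma tendsto_stdG_atTop : Tendsto stdG atTop (nhds 1) := by
  rw [← integral_normalPDF_zero_one]
  exact (aecover_Iic tendsto_id).integral_tendsto_of_countably_generated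
    integrable_normalPDF_zero_one

lemma stdG_lt_one (x : ℝ) : stdG x < 1 :=
  (strictMono_stdG (lt_add_one x)).trans_le
    (strictMono_stdG.monotone.ge_of_tendsto tendsto_stdG_atTop _)

lemma stdG_nonneg (x : ℝ) : 0 ≤ stdG x :=
  integral_nonneg fun t => (normalPDF_pos one_pos 0 t).le

lemma hasDerivAt_stdG_scaled {v : ℝ} (hv : 0 < v) (m x : ℝ) :
    HasDerivAt (fun y => stdG ((y - m) / √v)) (normalPDF m v x) x := by
  have h := (hasDerivAt_stdG ((x - m) / √v)).comp x
    (((hasDerivAt_id x).sub_const m).div_const (√v))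
  refine h.congr_deriv ?_
  have hs : √v ^ 2 = v := Real.sq_sqrt hv.le
  simp only [normalPDF, mul_one, sub_zero, div_pow, hs]
  rw [Real.sqrt_mul (by positivity) v, mul_inv]
  have : -((x - m) ^ 2 / v) / 2 = -(x - m) ^ 2 / (2 * v) := by field_simp
  rw [this]
  ring

lemma tendsto_stdG_scaled_atTop {v : ℝ} (hv : 0 < v) (m : ℝ) :
    Tendsto (fun y => stdG ((y - m) / √v)) atTop (nhds 1) :=
  tendsto_stdG_atTop.comp
    ((tendsto_atTop_add_const_right _ (-m) tendsto_id).atTop_div_const (Real.sqrt_pos.2 hv))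

/-- If the likelihood ratio `f / g` of two distributions strictly decreases up to `c`, strictly
increases after `c` and explodes at `-∞`, then it meets the ratio of the survival functions
exactly once. -/
lemma existsUnique_ratio_eq_survival_ratio {F G f g : ℝ → ℝ} {c : ℝ}
    (hF : ∀ x, HasDerivAt F (f x) x) (hG : ∀ x, HasDerivAt G (g x) x)
    (hF0 : ∀ x, 0 ≤ F x) (hG1 : ∀ x, G x < 1) (hg : ∀ x, 0 < g x)
    (hFtop : Tendsto F atTop (nhds 1)) (hGtop : Tendsto G atTop (nhds 1))
    (hcont : Continuous fun x => f x / g x)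
    (hanti : StrictAntiOn (fun x => f x / g x) (Set.Iic c))
    (hmono : StrictMonoOn (fun x => f x / g x) (Set.Ici c))
    (hbot : Tendsto (fun x => f x / g x) atBot atTop) :
    ∃! x, f x / g x = (1 - F x) / (1 - G x) := by
  set r : ℝ → ℝ := fun x => f x / g x with hr
  have hf (t : ℝ) : f t = r t * g t := by simp [hr, (hg t).ne']
  have hk (a t : ℝ) : HasDerivAt (fun s => (1 - F s) - a * (1 - G s)) (g t * (a - r t)) t := by
    refine (((hF t).const_sub 1).sub (((hG t).const_sub 1).const_mul a)).congr_deriv ?_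
    rw [hf t]
    ring
  have hkc (a : ℝ) : Continuous fun s => (1 - F s) - a * (1 - G s) :=
    continuous_iff_continuousAt.2 fun t => (hk a t).continuousAt
  set E : ℝ → ℝ := fun x => r x * (1 - G x) - (1 - F x) with hE
  have hiff (x : ℝ) : r x = (1 - F x) / (1 - G x) ↔ E x = 0 := by
    rw [eq_div_iff (sub_pos.2 (hG1 x)).ne', hE]
    exact sub_eq_zero.symm
  have hEneg : ∀ x, c ≤ x → E x < 0 := by
    intro x hx
    have hant : StrictAntiOn (fun s => (1 - F s) - r x * (1 - G s)) (Set.Ici x) := by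
      refine strictAntiOn_of_deriv_neg (convex_Ici x) (hkc _).continuousOn fun t ht => ?_
      rw [interior_Ici] at ht
      rw [(hk _ t).deriv]
      exact mul_neg_of_pos_of_neg (hg t) (sub_neg.2 (hmono hx (hx.trans ht.le) ht))
    have hlim : Tendsto (fun s => (1 - F s) - r x * (1 - G s)) atTop (nhds 0) := by
      simpa using (hFtop.const_sub 1).sub ((hGtop.const_sub 1).const_mul (r x))
    have h1 := hant (Set.self_mem_Ici) (Set.mem_Ici.2 (lt_add_one x).le) (lt_add_one x)
    have h2 : (0 : ℝ) ≤ (1 - F (x + 1)) - r x * (1 - G (x + 1)) := by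
      refine le_of_tendsto hlim ?_
      filter_upwards [eventually_ge_atTop (x + 1)] with s hs
      exact hant.antitoneOn (Set.mem_Ici.2 (lt_add_one x).le)
        (Set.mem_Ici.2 ((lt_add_one x).le.trans hs)) hs
    simp only [hE] at h1 ⊢
    linarith
  have hEanti : StrictAntiOn E (Set.Iic c) := by
    intro x hx y hy hxy
    have hmon : StrictMonoOn (fun s => (1 - F s) - r x * (1 - G s)) (Set.Icc x y) := by
      refine strictMonoOn_of_deriv_pos (convex_Icc x y) (hkc _).continuousOn fun t ht => ?_
      rw [interior_Icc] at ht
      rw [(hk _ t).deriv]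
      exact mul_pos (hg t) (sub_pos.2 (hanti hx (ht.2.le.trans hy) ht.1))
    have h1 := hmon (Set.left_mem_Icc.2 hxy.le) (Set.right_mem_Icc.2 hxy.le) hxy
    have h2 := mul_lt_mul_of_pos_right (hanti hx hy hxy) (sub_pos.2 (hG1 y))
    simp only [hE] at h1 h2 ⊢
    linarith
  have hEcont : Continuous E := by
    have hFc : Continuous F := continuous_iff_continuousAt.2 fun t => (hF t).continuousAt
    have hGc : Continuous G := continuous_iff_continuousAt.2 fun t => (hG t).continuousAt
    exact (hcont.mul (continuous_const.sub hGc)).sub (continuous_const.sub hFc)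
  obtain ⟨a, hac, ha⟩ : ∃ a ≤ c, 0 ≤ E a := by
    have hGc : 0 < 1 - G c := sub_pos.2 (hG1 c)
    obtain ⟨a, ha, hac⟩ := ((hbot.eventually_ge_atTop (1 / (1 - G c))).and
      (eventually_le_atBot c)).exists
    have hGm : G a ≤ G c := (strictMono_of_hasDerivAt_pos hG hg).monotone hac
    have h1 : 1 ≤ r a * (1 - G c) := (div_le_iff₀ hGc).1 ha
    have hra : 0 ≤ r a := (one_div_pos.2 hGc).le.trans ha
    have h2 := mul_le_mul_of_nonneg_left (sub_le_sub_left hGm 1) hra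
    refine ⟨a, hac, ?_⟩
    simp only [hE]
    linarith [hF0 a]
  obtain ⟨x, hx, hx0⟩ := intermediate_value_Icc' hac hEcont.continuousOn
    ⟨(hEneg c le_rfl).le, ha⟩
  refine ⟨x, (hiff x).2 hx0, fun y hy => ?_⟩
  have hy0 : E y = 0 := (hiff y).1 hy
  have hyc : y ≤ c := le_of_not_ge fun h => (hEneg y h).ne hy0
  exact hEanti.injOn hyc hx.2 (hy0.trans hx0.symm)

lemma normalPDF_div_normalPDF {v w : ℝ} (hw : 0 < w) (hwv : w < v) (m t : ℝ) :
    normalPDF 0 v t / normalPDF m w t =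
      (√(2 * Real.pi * w) / √(2 * Real.pi * v) * Real.exp (-m ^ 2 / (2 * (v - w)))) *
        Real.exp ((v - w) / (2 * v * w) * (t - v * m / (v - w)) ^ 2) := by
  have hv : 0 < v := hw.trans hwv
  have hvw : v - w ≠ 0 := (sub_pos.2 hwv).ne'
  have hexp : -(t - 0) ^ 2 / (2 * v) - -(t - m) ^ 2 / (2 * w) =
      -m ^ 2 / (2 * (v - w)) + (v - w) / (2 * v * w) * (t - v * m / (v - w)) ^ 2 := by
    field_simp
    ring
  rw [mul_assoc, ← Real.exp_add, ← hexp, Real.exp_sub]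
  simp only [normalPDF]
  field_simp

/-- Gaussian case: the likelihood ratio of `N(0, v)` over `N(m, w)`, `w < v`, meets the ratio of
the survival functions exactly once. -/
lemma existsUnique_normalPDF_ratio {v w : ℝ} (hw : 0 < w) (hwv : w < v) (m : ℝ) :
    ∃! x, normalPDF 0 v x / normalPDF m w x =
      (1 - stdG ((x - 0) / √v)) / (1 - stdG ((x - m) / √w)) := by
  have hv : 0 < v := hw.trans hwv
  set c := v * m / (v - w)
  set A := (v - w) / (2 * v * w)
  set C := √(2 * Real.pi * w) / √(2 * Real.pi * v) * Real.exp (-m ^ 2 / (2 * (v - w)))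
  have hA : 0 < A := div_pos (sub_pos.2 hwv) (by positivity)
  have hC : 0 < C := by positivity
  have hr : (fun t => normalPDF 0 v t / normalPDF m w t) =
      fun t => C * Real.exp (A * (t - c) ^ 2) :=
    funext fun t => normalPDF_div_normalPDF hw hwv m t
  have hlt {s t : ℝ} (h : (s - c) ^ 2 < (t - c) ^ 2) :
      C * Real.exp (A * (s - c) ^ 2) < C * Real.exp (A * (t - c) ^ 2) := by gcongr
  refine existsUnique_ratio_eq_survival_ratio (c := c)
    (hasDerivAt_stdG_scaled hv 0) (hasDerivAt_stdG_scaled hw m)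
    (fun x => stdG_nonneg _) (fun x => stdG_lt_one _) (normalPDF_pos hw m)
    (tendsto_stdG_scaled_atTop hv 0) (tendsto_stdG_scaled_atTop hw m) ?_ ?_ ?_ ?_
  · rw [hr]
    fun_prop
  · rw [hr]
    intro x hx y hy hxy
    rw [Set.mem_Iic] at hx hy
    exact hlt (by nlinarith)
  · rw [hr]
    intro x hx y hy hxy
    rw [Set.mem_Ici] at hx hy
    exact hlt (by nlinarith)
  · rw [hr]
    have hsq : Tendsto (fun t : ℝ => (t - c) ^ 2) atBot atTop := by
      have hlin : Tendsto (fun t : ℝ => t - c) atBot atBot :=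
        tendsto_atBot_add_const_right _ (-c) tendsto_id
      simpa only [sq] using hlin.atBot_mul_atBot₀ hlin
    exact (Real.tendsto_exp_atTop.comp (hsq.const_mul_atTop hA)).const_mul_atTop hC

/-- in the case `H(P)/V(P) < H(Q)/V(Q)`, the equation
`N_P(x)/N_{P,Q,b}(x) = (1 − G_P(x))/(1 − G_{P,Q,b}(x))` has a unique real solution. -/
theorem unique_threshold_beta {X Y : Type*} [Fintype X] [Fintype Y]
    (P : X → ℝ) (Q : Y → ℝ) (hP : IsProb P) (hQ : IsProb Q)
    (hVP : 0 < V P) (hVQ : 0 < V Q)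
    (hratio : H P / V P < H Q / V Q) (b : ℝ) :
    ∃! x : ℝ,
      NP P x / NPQ P Q b x = (1 - GP P x) / (1 - GPQ P Q b x) := by
  have hHP := H_pos_of_V_pos hP hVP
  have hHQ := H_pos_of_V_pos hQ hVQ
  have hw : 0 < H P / H Q * V Q := by positivity
  have hwv : H P / H Q * V Q < V P := by
    rw [div_lt_div_iff₀ hVP hVQ] at hratio
    rw [div_mul_eq_mul_div, div_lt_iff₀ hHQ]
    linarith
  have hscale (x : ℝ) : √(H Q / (H P * V Q)) * (x - H Q * b) =
      (x - H Q * b) / √(H P / H Q * V Q) := by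
    have : H Q / (H P * V Q) = (H P / H Q * V Q)⁻¹ := by field_simp
    rw [this, Real.sqrt_inv]
    ring
  simpa only [NP, NPQ, GP, GPQ, hscale, sub_zero] using
    existsUnique_normalPDF_ratio hw hwv (H Q * b)

end RNG
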